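/- Let 𝒜 be the explicit operator of order 11 on ℝ² with wave cone Λ_𝒜 as in the context, and A_1 = (a_1, a_2, a_3, a_4) ∈ (ℝ³)⁴. Then there exist δ > 0 and, for each ℓ ∈ {1,2,3,4}, smooth maps π_ℓ : (−δ,δ)³ × B_δ(A_1) → ℝ³ such that: (i) for each fixed X = (x_1,x_2,x_3,x_4) ∈ B_δ(A_1), the map t ↦ π_ℓ(t, X) is an embedding; (ii) π_ℓ(t, X) ∈ {x_1,x_2,x_3,x_4}^{Λ_𝒜} for all t ∈ [0,δ)³ and X ∈ B_δ(A_1); (iii) π_ℓ(0, X) = x_ℓ for all X ∈ B_δ(A_1). -/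

import Mathlib

open MeasureTheory Metric Set Matrix Filter

/-- The four states `a_1 = 0`, `a_2 = e_1`, `a_3 = e_2`, `a_4 = e_3` in `ℝ³`. -/
def aPt : Fin 4 → (Fin 3 → ℝ) := ![![0,0,0], ![1,0,0], ![0,1,0], ![0,0,1]]

/-- The permutations `σ₁ = (1,2,3,4)`, `σ₂ = (4,1,2,3)`, `σ₃ = (3,4,1,2)` (zero-indexed). -/
def sigmaP : Fin 3 → Fin 4 → Fin 4 := ![![0,1,2,3], ![3,0,1,2], ![2,3,0,1]]

/-- The inverse permutations of `sigmaP`. -/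
def sigmaInv : Fin 3 → Fin 4 → Fin 4 := ![![0,1,2,3], ![1,2,3,0], ![2,3,0,1]]

/-- The base points `p^{σ_i}`. -/
noncomputable def pVal : Fin 3 → (Fin 3 → ℝ) :=
  ![![2/15, 4/15, 8/15], ![18/65, 27/65, 8/65], ![64/175, 27/175, 36/175]]

/-- The vectors `c^{σ_i}_ℓ`. -/
noncomputable def cVal : Fin 3 → Fin 4 → (Fin 3 → ℝ) :=
  ![![![-1/15, -2/15, -4/15], ![7/15, -1/15, -2/15],
      ![-4/15, 7/15, -1/15], ![-2/15, -4/15, 7/15]],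
    ![![-6/65, -9/65, 19/65], ![-4/65, -6/65, -9/65],
      ![19/65, -4/65, -6/65], ![-9/65, 19/65, -4/65]],
    ![![-16/175, 37/175, -9/175], ![-12/175, -16/175, 37/175],
      ![-9/175, -12/175, -16/175], ![37/175, -9/175, -12/175]]]

/-- The coefficients `k^{σ_i}_ℓ = i + 1` (`= 2, 3, 4` for `i = 1, 2, 3`). -/
def kVal : Fin 3 → ℝ := ![2, 3, 4]

/-- The interpolation points `(ξ^{σ_i}_{2ℓ-1}, ξ^{σ_i}_{2ℓ}) ∈ ℝ²`. -/
def xiVal : Fin 3 → Fin 4 → (Fin 2 → ℝ) :=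
  ![![![-14, 5], ![19, -8], ![11, -14], ![-4, -17]],
    ![![-7, -3], ![6, 16], ![2, -17], ![-18, 2]],
    ![![-7, -14], ![-9, 19], ![6, 18], ![-20, -9]]]

/-- The 36 interpolation conditions (together with homogeneity of degree 11) that determine
the polynomials `q₁, q₂, q₃`. -/
def InterpCond (q : Fin 3 → MvPolynomial (Fin 2) ℝ) : Prop :=
  (∀ j : Fin 3, (q j).IsHomogeneous 11) ∧
  ∀ (i : Fin 3) (ℓ : Fin 4) (j : Fin 3),
    MvPolynomial.eval (xiVal i ℓ) (q j) = cVal i ℓ j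

/-- The symbol `𝔸(ξ)` of the operator `𝒜`, built from `q₁, q₂, q₃`. -/
noncomputable def AMat (q : Fin 3 → MvPolynomial (Fin 2) ℝ) (ξ : Fin 2 → ℝ) :
    Matrix (Fin 3) (Fin 3) ℝ :=
  !![0, -(MvPolynomial.eval ξ (q 2)), MvPolynomial.eval ξ (q 1);
     -(MvPolynomial.eval ξ (q 2)), 0, MvPolynomial.eval ξ (q 0);
     -(MvPolynomial.eval ξ (q 1)), MvPolynomial.eval ξ (q 0), 0]

/-- The wave cone `Λ_𝒜 = ⋃_{ξ ≠ 0} ker 𝔸(ξ)` of the explicit operator. -/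
def LamA (q : Fin 3 → MvPolynomial (Fin 2) ℝ) : Set (Fin 3 → ℝ) :=
  {η | ∃ ξ : Fin 2 → ℝ, ξ ≠ 0 ∧ (AMat q ξ).mulVec η = 0}

/-- A `Λ`-convex function on `ℝ³`. -/
def LamConvex (Λ : Set (Fin 3 → ℝ)) (f : (Fin 3 → ℝ) → ℝ) : Prop :=
  ∀ a b : Fin 3 → ℝ, a - b ∈ Λ → ∀ t : ℝ, t ∈ Set.Icc (0:ℝ) 1 →
    f (t • a + (1 - t) • b) ≤ t * f a + (1 - t) * f b

/-- The `Λ`-convex hull of a (compact) set `K`: barycentres of laminates supported in `K`. -/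
def lamHull (Λ : Set (Fin 3 → ℝ)) (K : Set (Fin 3 → ℝ)) : Set (Fin 3 → ℝ) :=
  {x | ∃ ν : Measure (Fin 3 → ℝ), IsProbabilityMeasure ν ∧ ν Kᶜ = 0 ∧
        x = ∫ y, y ∂ν ∧
        ∀ f : (Fin 3 → ℝ) → ℝ, Continuous f → LamConvex Λ f → f x ≤ ∫ y, f y ∂ν}

/-- Common denominator of the coefficients of `q₁, q₂, q₃`. -/
def qDen : ℤ :=
  259029177080458595011050268246419308229635645339981756631366424598164145419447910400000

/-- `qNum i j` is `qDen` times the coefficient of `x ^ i * y ^ (11 - i)` in `q_j`. -/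
def qNum : Fin 12 → Fin 3 → ℤ :=
  ![![-1178089049643133931513286935049033087307780873685225485089616431088887217920,
      -1757126862473466426246660080421766051055816504100927533200207752431983908480,
      3699983109404199064183134959826356654858936546331719750653290916776419129280],
    ![-467287400588702357095393277471362133747359766465658149494504069485817178496,
      -695813189919726045054080456924182591835687100744112444354443166730496757824,
      1443315497520114347844716342920961244600415996627638621365912483090221296864],
    ![68784377705505513935347581581861516123518113059952057891243934453920563492112,
      102774749252295845070427121935527356111703185537507299751180441167292209630488,
      -216396978577269967986055873666286284945022189219034427587294966342015975152388],
    ![-166197879740153028519252236335832560810250626576131858459531659178712415752224,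
      -248891078404719617073602165183835559468924633255137277563137132568024533386896,
      524823226657687893415127881724573765998533756106332331214697229929264942917936],
    ![-406171318228508559670338161555192719077143078969785384855801490622753225137988,
      -606307225059247673139930387073530351451534658408011209375255807934445962620102,
      1276491652738343385227090727314303974835345624759353384705758344798563298967257],
    ![1176767910887625366576567699421979466471794230573163273062584711882802154936136,
      1762915435509829041699907754682479085264950237978364328651041633918313635314724,
      -3717855056905220722279953926073570622219106495366459352400994870289119710677044],
    ![755718117580564772247912173085355169280553674190219767552734583585972101004624,
      1126452319665140232197752412736757583926523153122192797720474107818425751842216,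
      -2373942148928667737322598563981970026355695602363090216874402178132594643571846],
    ![-1952649608442240444953049388239339243788091179463520576458383573122426111945896,
      -2928697441306585913704111438051230790392937912745645989695759258007017514354884,
      6177961725791439698796256645674452269499247908258449128107072889999655605798644],
    ![-935197606861021312140208439211335088373719177794220246658935850192875474060972,
      -1400366691337981381500065032327134501216395116956928090789097189857701112903938,
      2956390165642332184591155796994223193922790108824968756293183783308920279424533],
    ![277526086311080517484938425692127279706120500136225885212401458338189055837600,
      416444517239406465498711325289542559751957416760031082135515404582163996156560,
      -878276750661090225423390931087000203295199932981431608003292366440995072233680],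
    ![163106031253418892704282046987813050316866852639752359652392494031030016274544,
      244437404095638935190823779778475230122816178060818110428528565866087434037416,
      -516155412140983742798684295610628539857881887675355767051035059663388584498436],
    ![13722470108359827630697394859672449462152210385001705593679714607967634468480,
      20558319492517606455624414127159887979300769907876677636179525432608512310720,
      -43426597489245866818657884860765061634607265903950800719213203477155623201120]]

/-- The integer points `xiVal`. -/
def xiInt : Fin 3 → Fin 4 → (Fin 2 → ℤ) :=
  ![![![-14, 5], ![19, -8], ![11, -14], ![-4, -17]],
    ![![-7, -3], ![6, 16], ![2, -17], ![-18, 2]],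
    ![![-7, -14], ![-9, 19], ![6, 18], ![-20, -9]]]

/-- The integer numerators of `cVal`. -/
def cInt : Fin 3 → Fin 4 → (Fin 3 → ℤ) :=
  ![![![-1, -2, -4], ![7, -1, -2], ![-4, 7, -1], ![-2, -4, 7]],
    ![![-6, -9, 19], ![-4, -6, -9], ![19, -4, -6], ![-9, 19, -4]],
    ![![-16, 37, -9], ![-12, -16, 37], ![-9, -12, -16], ![37, -9, -12]]]

/-- The common denominators of `cVal`. -/
def cDen : Fin 3 → ℤ := ![15, 65, 175]

/-- `qDen` times the derivative of `q` at `xiVal i ℓ` in the second coordinate direction. -/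
def tangentInt (i : Fin 3) (ℓ : Fin 4) : Fin 3 → ℤ := fun j =>
  ∑ m : Fin 12, qNum m j * (xiInt i ℓ 0 ^ (m : ℕ) *
    ((m.rev : ℕ) * xiInt i ℓ 1 ^ ((m.rev : ℕ) - 1)))

theorem xiVal_eq_cast (i : Fin 3) (ℓ : Fin 4) (j : Fin 2) : xiVal i ℓ j = xiInt i ℓ j := by
  fin_cases i <;> fin_cases ℓ <;> fin_cases j <;> simp [xiVal, xiInt]

theorem cDen_mul_cVal (i : Fin 3) (ℓ : Fin 4) (j : Fin 3) :
    (cDen i : ℝ) * cVal i ℓ j = cInt i ℓ j := by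
  fin_cases i <;> fin_cases ℓ <;> fin_cases j <;> norm_num [cVal, cInt, cDen]

theorem qNum_interpolates : ∀ (i : Fin 3) (ℓ : Fin 4) (j : Fin 3),
    cDen i * ∑ m : Fin 12, qNum m j * (xiInt i ℓ 0 ^ (m : ℕ) * xiInt i ℓ 1 ^ (m.rev : ℕ)) =
      qDen * cInt i ℓ j := by
  decide +kernel

/-- The indices `(i, ℓ)` of the twelve interpolation points, in a single list. -/
def ptIdx (n : Fin 12) : Fin 3 × Fin 4 := (finProdFinEquiv (m := 3) (n := 4)).symm n

theorem xiInt_not_parallel : ∀ m n : Fin 12, m < n →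
    xiInt (ptIdx n).1 (ptIdx n).2 0 * xiInt (ptIdx m).1 (ptIdx m).2 1 -
      xiInt (ptIdx m).1 (ptIdx m).2 0 * xiInt (ptIdx n).1 (ptIdx n).2 1 ≠ 0 := by
  decide +kernel

theorem cross_cInt_tangentInt_ne_zero : ∀ (i : Fin 3) (ℓ : Fin 4),
    cInt i ℓ ⨯₃ tangentInt i ℓ ≠ 0 := by
  decide +kernel

theorem eval_eq_sum_fin {n : ℕ} {f : MvPolynomial (Fin 2) ℝ} (hf : f.IsHomogeneous n)
    (ξ : Fin 2 → ℝ) :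
    MvPolynomial.eval ξ f = ∑ m : Fin (n + 1),
      f.coeff (Finsupp.single 0 (m : ℕ) + Finsupp.single 1 (m.rev : ℕ)) *
        (ξ 0 ^ (m : ℕ) * ξ 1 ^ (m.rev : ℕ)) := by
  have key : ∀ d : Fin 2 →₀ ℕ, d 0 + d 1 = n →
      d = Finsupp.single 0 (d 0) + Finsupp.single 1 (n - d 0) := by
    intro d hd
    ext i
    fin_cases i
    · simp
    · simp
      omega
  have hdeg : ∀ d ∈ f.support, d 0 + d 1 = n := by
    intro d hd
    have : d.degree = n := by_contra fun h => MvPolynomial.mem_support_iff.1 hd (hf.coeff_eq_zero h)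
    rwa [Finsupp.degree_eq_sum, Fin.sum_univ_two] at this
  rw [MvPolynomial.eval_eq']
  refine Finset.sum_of_injOn (fun d => Fin.ofNat (n + 1) (d 0)) ?_ (by simp) ?_ ?_
  · intro d hd e he hde
    have h1 := hdeg d hd
    have h2 := hdeg e he
    have h3 : d 0 = e 0 := by
      simpa [Fin.ext_iff, Nat.mod_eq_of_lt (show d 0 < n + 1 by omega),
        Nat.mod_eq_of_lt (show e 0 < n + 1 by omega)] using hde
    rw [key d h1, key e h2, h3]
  · intro m _ hm
    by_contra hne
    refine hm ⟨_, MvPolynomial.mem_support_iff.2 (left_ne_zero_of_mul hne), ?_⟩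
    simp
  · intro d hd
    have h1 := hdeg d hd
    have h2 : (Fin.ofNat (n + 1) (d 0) : ℕ) = d 0 := by
      simp [Nat.mod_eq_of_lt (show d 0 < n + 1 by omega)]
    have h3 : ((Fin.ofNat (n + 1) (d 0)).rev : ℕ) = n - d 0 := by
      rw [Fin.val_rev, h2]; omega
    rw [h2, h3, ← key d h1, Fin.prod_univ_two, show n - d 0 = d 1 by omega]

theorem qDen_mul_eval {q : Fin 3 → MvPolynomial (Fin 2) ℝ} (hq : InterpCond q) (j : Fin 3)
    (ξ : Fin 2 → ℝ) :
    (qDen : ℝ) * MvPolynomial.eval ξ (q j) =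
      ∑ m : Fin 12, (qNum m j : ℝ) * (ξ 0 ^ (m : ℕ) * ξ 1 ^ (m.rev : ℕ)) := by
  set b : Fin 12 → ℝ := fun m => (qDen : ℝ) *
    (q j).coeff (Finsupp.single 0 (m : ℕ) + Finsupp.single 1 (m.rev : ℕ)) - qNum m j with hb
  have hsub : ∀ ξ : Fin 2 → ℝ, ∑ m : Fin 12, (ξ 0 ^ (m : ℕ) * ξ 1 ^ (m.rev : ℕ)) * b m =
      (qDen : ℝ) * MvPolynomial.eval ξ (q j) -
        ∑ m : Fin 12, (qNum m j : ℝ) * (ξ 0 ^ (m : ℕ) * ξ 1 ^ (m.rev : ℕ)) := by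
    intro ξ
    rw [eval_eq_sum_fin (hq.1 j), Finset.mul_sum, ← Finset.sum_sub_distrib]
    refine Finset.sum_congr rfl fun m _ => ?_
    simp only [hb]
    ring
  have hzero : ∀ i ℓ, ∑ m : Fin 12, (xiVal i ℓ 0 ^ (m : ℕ) * xiVal i ℓ 1 ^ (m.rev : ℕ)) * b m
      = 0 := by
    intro i ℓ
    have hd : (cDen i : ℝ) ≠ 0 := by fin_cases i <;> norm_num [cDen]
    have h := congrArg (Int.cast : ℤ → ℝ) (qNum_interpolates i ℓ j)
    push_cast at h
    rw [hsub, hq.2, sub_eq_zero]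
    refine mul_left_cancel₀ hd ?_
    simp only [xiVal_eq_cast]
    rw [h, ← cDen_mul_cVal]
    ring
  have hb0 : b = 0 := by
    refine Matrix.eq_zero_of_mulVec_eq_zero (M := Matrix.projVandermonde
      (fun n : Fin 12 => xiVal (ptIdx n).1 (ptIdx n).2 0)
      (fun n : Fin 12 => xiVal (ptIdx n).1 (ptIdx n).2 1)) ?_ ?_
    · rw [Matrix.det_projVandermonde]
      refine Finset.prod_ne_zero_iff.2 fun m _ => Finset.prod_ne_zero_iff.2 fun n hn => ?_
      simp only [xiVal_eq_cast]
      exact_mod_cast xiInt_not_parallel m n (Finset.mem_Ioi.1 hn)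
    · funext n
      exact hzero _ _
  have := hsub ξ
  rw [hb0] at this
  simp only [Pi.zero_apply, mul_zero, Finset.sum_const_zero] at this
  linarith

/-- `x` is the barycentre of a `Λ`-laminate supported on the points of the finite family `X`. -/
def IsLaminateOf {ι : Type*} [Fintype ι] (Λ : Set (Fin 3 → ℝ)) (X : ι → (Fin 3 → ℝ))
    (x : Fin 3 → ℝ) : Prop :=
  ∃ w : ι → ℝ, (∀ i, 0 ≤ w i) ∧ ∑ i, w i = 1 ∧
    ∀ f : (Fin 3 → ℝ) → ℝ, LamConvex Λ f → f x ≤ ∑ i, w i * f (X i)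

namespace IsLaminateOf

variable {ι κ : Type*} [Fintype ι] [Fintype κ] {Λ : Set (Fin 3 → ℝ)} {X : ι → (Fin 3 → ℝ)}
  {x y : Fin 3 → ℝ}

theorem self (i : ι) : IsLaminateOf Λ X (X i) := by
  classical
  refine ⟨Pi.single i 1, fun j => ?_, by simp, fun f _ => by simp [Pi.single_apply]⟩
  by_cases h : j = i <;> simp [h]

theorem segment (hx : IsLaminateOf Λ X x) (hy : IsLaminateOf Λ X y) (hxy : x - y ∈ Λ) {t : ℝ}
    (ht : t ∈ Set.Icc (0 : ℝ) 1) : IsLaminateOf Λ X (t • x + (1 - t) • y) := by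
  obtain ⟨w, hw0, hw1, hw⟩ := hx
  obtain ⟨v, hv0, hv1, hv⟩ := hy
  have ht' : 0 ≤ 1 - t := sub_nonneg.2 ht.2
  refine ⟨fun i => t * w i + (1 - t) * v i, fun i => ?_, ?_, fun f hf => ?_⟩
  · exact add_nonneg (mul_nonneg ht.1 (hw0 i)) (mul_nonneg ht' (hv0 i))
  · rw [Finset.sum_add_distrib, ← Finset.mul_sum, ← Finset.mul_sum, hw1, hv1]
    ring
  · calc f (t • x + (1 - t) • y) ≤ t * f x + (1 - t) * f y := hf x y hxy t ht
      _ ≤ t * ∑ i, w i * f (X i) + (1 - t) * ∑ i, v i * f (X i) :=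
        add_le_add (mul_le_mul_of_nonneg_left (hw f hf) ht.1)
          (mul_le_mul_of_nonneg_left (hv f hf) ht')
      _ = ∑ i, (t * w i + (1 - t) * v i) * f (X i) := by
        rw [Finset.mul_sum, Finset.mul_sum, ← Finset.sum_add_distrib]
        exact Finset.sum_congr rfl fun i _ => by ring

theorem trans {Y : κ → (Fin 3 → ℝ)} (hY : ∀ k, IsLaminateOf Λ X (Y k))
    (hx : IsLaminateOf Λ Y x) : IsLaminateOf Λ X x := by
  choose w hw0 hw1 hw using hY
  obtain ⟨v, hv0, hv1, hv⟩ := hx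
  refine ⟨fun i => ∑ k, v k * w k i, fun i => Finset.sum_nonneg fun k _ =>
    mul_nonneg (hv0 k) (hw0 k i), ?_, fun f hf => ?_⟩
  · rw [Finset.sum_comm]
    simp [← Finset.mul_sum, hw1, hv1]
  · calc f x ≤ ∑ k, v k * f (Y k) := hv f hf
      _ ≤ ∑ k, v k * ∑ i, w k i * f (X i) :=
        Finset.sum_le_sum fun k _ => mul_le_mul_of_nonneg_left (hw k f hf) (hv0 k)
      _ = ∑ i, (∑ k, v k * w k i) * f (X i) := by
        simp only [Finset.mul_sum, Finset.sum_mul]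
        rw [Finset.sum_comm]
        exact Finset.sum_congr rfl fun i _ => Finset.sum_congr rfl fun k _ => by ring

theorem mem_lamHull (hx : IsLaminateOf Λ X x) : x ∈ lamHull Λ (Set.range X) := by
  obtain ⟨w, hw0, hw1, hw⟩ := hx
  have hint : ∀ {F : Type} [NormedAddCommGroup F] [NormedSpace ℝ F] [CompleteSpace F]
      (g : (Fin 3 → ℝ) → F),
      ∫ y, g y ∂(∑ i, ENNReal.ofReal (w i) • Measure.dirac (X i)) = ∑ i, w i • g (X i) := by
    intro F _ _ _ g
    rw [integral_finsetSum_measure fun i _ =>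
      (integrable_dirac (by simp)).smul_measure ENNReal.ofReal_ne_top]
    simp [integral_smul_measure, ENNReal.toReal_ofReal (hw0 _)]
  have hbary : x = ∑ i, w i • X i := by
    have hlin : ∀ c : ℝ, ∀ j : Fin 3, c * x j ≤ ∑ i, w i * (c * X i j) := fun c j =>
      hw (fun y => c * y j) fun a b _ t _ => by
        simp only [Pi.add_apply, Pi.smul_apply, smul_eq_mul]
        exact le_of_eq (by ring)
    funext j
    have h1 := hlin 1 j
    have h2 := hlin (-1) j
    simp only [one_mul, neg_mul, mul_neg, Finset.sum_neg_distrib] at h1 h2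
    simp only [Finset.sum_apply, Pi.smul_apply, smul_eq_mul]
    linarith
  refine ⟨∑ i, ENNReal.ofReal (w i) • Measure.dirac (X i), ⟨?_⟩, ?_, ?_, fun f _ hf => ?_⟩
  · simp [← ENNReal.ofReal_sum_of_nonneg fun i _ => hw0 i, hw1]
  · simp
  · rw [hint, hbary]
  · rw [hint]
    exact hw f hf

end IsLaminateOf

/-- The inner points of a `T₄` configuration are barycentres of laminates supported on its
outer points. -/
theorem isLaminateOf_T4 {Λ : Set (Fin 3 → ℝ)} {x p : Fin 4 → (Fin 3 → ℝ)} {lam : Fin 4 → ℝ}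
    (hlam : ∀ ℓ, lam ℓ ∈ Set.Ioo (0 : ℝ) 1)
    (hp : ∀ ℓ, p (ℓ + 1) = lam ℓ • x ℓ + (1 - lam ℓ) • p ℓ) (hΛ : ∀ ℓ, x ℓ - p ℓ ∈ Λ) (ℓ : Fin 4) :
    IsLaminateOf Λ x (p ℓ) := by
  have hI : ∀ ℓ, lam ℓ ∈ Set.Icc (0 : ℝ) 1 := fun ℓ => ⟨(hlam ℓ).1.le, (hlam ℓ).2.le⟩
  have step : ∀ ℓ, IsLaminateOf Λ x (p ℓ) → IsLaminateOf Λ x (p (ℓ + 1)) := fun ℓ h => by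
    rw [hp]
    exact (IsLaminateOf.self ℓ).segment h (hΛ ℓ) (hI ℓ)
  have h0 : IsLaminateOf Λ x (p 0) := by
    obtain ⟨⟨a0, b0⟩, ⟨a1, b1⟩, ⟨a2, b2⟩, ⟨a3, b3⟩⟩ := And.intro (hlam 0)
      (And.intro (hlam 1) (And.intro (hlam 2) (hlam 3)))
    have c0 : 0 < 1 - lam 0 := by linarith
    have c1 : 0 < 1 - lam 1 := by linarith
    have c2 : 0 < 1 - lam 2 := by linarith
    have c3 : 0 < 1 - lam 3 := by linarith
    set D : ℝ := 1 - (1 - lam 3) * ((1 - lam 2) * ((1 - lam 1) * (1 - lam 0))) with hD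
    have hDpos : 0 < D := by
      have e1 : (1 - lam 1) * (1 - lam 0) < 1 := by nlinarith
      have e2 : (1 - lam 2) * ((1 - lam 1) * (1 - lam 0)) < 1 := by nlinarith
      have e3 : (1 - lam 3) * ((1 - lam 2) * ((1 - lam 1) * (1 - lam 0))) < 1 := by nlinarith
      linarith
    refine ⟨![(1 - lam 3) * (1 - lam 2) * (1 - lam 1) * lam 0 / D,
      (1 - lam 3) * (1 - lam 2) * lam 1 / D, (1 - lam 3) * lam 2 / D, lam 3 / D], ?_, ?_, ?_⟩
    · intro i
      fin_cases i <;> simp <;> positivity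
    · simp only [Fin.sum_univ_four, Matrix.cons_val]
      field_simp
      rw [hD]
      ring
    · intro f hf
      have hstep : ∀ ℓ, f (p (ℓ + 1)) ≤ lam ℓ * f (x ℓ) + (1 - lam ℓ) * f (p ℓ) := fun ℓ => by
        rw [hp]
        exact hf _ _ (hΛ ℓ) _ (hI ℓ)
      have g0 := hstep 0
      have g1 := (hstep 1).trans (add_le_add le_rfl (mul_le_mul_of_nonneg_left g0 c1.le))
      have g2 := (hstep 2).trans (add_le_add le_rfl (mul_le_mul_of_nonneg_left g1 c2.le))
      have g3 := (hstep 3).trans (add_le_add le_rfl (mul_le_mul_of_nonneg_left g2 c3.le))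
      rw [show (3 + 1 : Fin 4) = 0 from rfl] at g3
      simp only [Fin.sum_univ_four, Matrix.cons_val]
      have : D * f (p 0) ≤ (1 - lam 3) * (1 - lam 2) * (1 - lam 1) * lam 0 * f (x 0) +
          (1 - lam 3) * (1 - lam 2) * lam 1 * f (x 1) + (1 - lam 3) * lam 2 * f (x 2) +
          lam 3 * f (x 3) := by
        rw [hD]
        linarith
      rw [← le_div_iff₀' hDpos] at this
      exact this.trans (le_of_eq (by ring))
  have h1 : IsLaminateOf Λ x (p 1) := step 0 h0
  have h2 : IsLaminateOf Λ x (p 2) := step 1 h1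
  have h3 : IsLaminateOf Λ x (p 3) := step 2 h2
  fin_cases ℓ <;> assumption

section InverseFunction

variable {E : Type*} [NormedAddCommGroup E] [NormedSpace ℝ E] [FiniteDimensional ℝ E]
  {f : E → E} {a : E}

theorem hasFDerivAt_equiv_of_injective (hf : DifferentiableAt ℝ f a)
    (hinj : ∀ v, fderiv ℝ f a v = 0 → v = 0) :
    ∃ f' : E ≃L[ℝ] E, HasFDerivAt f (f' : E →L[ℝ] E) a := by
  have hi : Function.Injective (fderiv ℝ f a : E →ₗ[ℝ] E) :=
    (injective_iff_map_eq_zero _).2 hinj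
  refine ⟨(LinearEquiv.ofInjectiveEndo _ hi).toContinuousLinearEquiv, ?_⟩
  convert hf.hasFDerivAt using 1
  ext v
  rfl

theorem exists_analytic_right_inverse (hf : ContDiffAt ℝ (⊤ : WithTop ℕ∞) f a)
    (hinj : ∀ v, fderiv ℝ f a v = 0 → v = 0) :
    ∃ g : E → E, ContDiffAt ℝ (⊤ : WithTop ℕ∞) g (f a) ∧ g (f a) = a ∧
      ∀ᶠ y in nhds (f a), f (g y) = y := by
  have : CompleteSpace E := FiniteDimensional.complete ℝ E
  obtain ⟨f', hf'⟩ := hasFDerivAt_equiv_of_injective (hf.differentiableAt (by simp)) hinj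
  exact ⟨hf.localInverse hf' (by simp), hf.to_localInverse hf' (by simp),
    hf.localInverse_apply_image hf' (by simp),
    (hf.hasStrictFDerivAt' hf' (by simp)).eventually_right_inverse⟩

end InverseFunction

/-- If the partial derivative of `π` in the first variable is injective at a point, then the partial
maps of `π` are embeddings on a uniform neighbourhood. -/
theorem exists_nhds_isEmbedding_slice {T E : Type*} [NormedAddCommGroup T] [NormedSpace ℝ T]
    [FiniteDimensional ℝ T] [NormedAddCommGroup E] [NormedSpace ℝ E] [FiniteDimensional ℝ E]
    {π : T × E → T} {a : T × E} (hπ : ContDiffAt ℝ (⊤ : WithTop ℕ∞) π a)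
    (hinj : ∀ v : T, fderiv ℝ π a (v, 0) = 0 → v = 0) :
    ∃ U ∈ nhds a, ∀ (s : Set T) (X : E), (∀ t ∈ s, (t, X) ∈ U) →
      Topology.IsEmbedding fun t : s => π ((t : T), X) := by
  have : CompleteSpace (T × E) := FiniteDimensional.complete ℝ _
  have hd : DifferentiableAt ℝ π a := hπ.differentiableAt (by simp)
  have hΘ : ContDiffAt ℝ (⊤ : WithTop ℕ∞) (fun z : T × E => (π z, z.2)) a :=
    hπ.prodMk contDiffAt_snd
  obtain ⟨f', hf'⟩ := hasFDerivAt_equiv_of_injective (hΘ.differentiableAt (by simp)) (by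
    rintro ⟨v, w⟩ h
    rw [(hd.hasFDerivAt.prodMk hasFDerivAt_snd).fderiv] at h
    simp only [ContinuousLinearMap.prod_apply, ContinuousLinearMap.coe_snd', Prod.mk_eq_zero] at h
    obtain ⟨h1, rfl⟩ := h
    rw [hinj v h1, Prod.mk_zero_zero])
  set e := hΘ.toOpenPartialHomeomorph _ hf' (by simp) with he
  refine ⟨e.source, e.open_source.mem_nhds (hΘ.mem_toOpenPartialHomeomorph_source hf' (by simp)),
    fun s X hs => ?_⟩
  have hemb : Topology.IsEmbedding fun z : e.source => (π z, (z : T × E).2) :=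
    (e.isOpenEmbedding_restrict).isEmbedding
  have hinc : Topology.IsEmbedding fun t : s => (⟨((t : T), X), hs t t.2⟩ : e.source) := by
    refine Topology.IsEmbedding.of_comp (f := fun t : s => (⟨((t : T), X), hs t t.2⟩ : e.source))
      (g := fun z => (z : T × E).1) (by fun_prop) (by fun_prop) ?_
    exact Topology.IsEmbedding.subtypeVal
  have hpair := hemb.comp hinc
  exact Topology.IsEmbedding.of_comp (g := fun y => (y, X)) (continuous_fst.comp hpair.continuous)
    (by fun_prop) hpair

/-- The matrix whose nonsingularity expresses the stability of a `T₄` configuration with outgoing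
directions `C ℓ` and constant ratio `u / v`, where the cone containing the directions has tangent
plane spanned by `C ℓ` and `T ℓ`. -/
def t4Matrix {R : Type*} [CommRing R] (u v : R) (C T : Fin 4 → (Fin 3 → R)) :
    Matrix (Fin 4) (Fin 4) R :=
  Matrix.of fun ℓ k =>
    u ^ ((ℓ + 3 * k + 3 : Fin 4) : ℕ) * v ^ ((ℓ + 3 * k + 3 : Fin 4).rev : ℕ) * ((C ℓ ⨯₃ T ℓ) ⬝ᵥ C k)

theorem t4_injective {u v : ℝ} {C T : Fin 4 → (Fin 3 → ℝ)} (huv : u ^ 4 ≠ v ^ 4)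
    (hdet : (t4Matrix u v C T).det ≠ 0) (hcross : ∀ ℓ, C ℓ ⨯₃ T ℓ ≠ 0) {a b m : Fin 4 → ℝ}
    (h : ∀ ℓ, v • (a (ℓ + 1) • C (ℓ + 1) + b (ℓ + 1) • T (ℓ + 1)) =
      u • (a ℓ • C ℓ + b ℓ • T ℓ) - m ℓ • C ℓ) :
    a = 0 ∧ b = 0 ∧ m = 0 := by
  set y : Fin 4 → (Fin 3 → ℝ) := fun ℓ => a ℓ • C ℓ + b ℓ • T ℓ with hy
  have hny : ∀ ℓ, (C ℓ ⨯₃ T ℓ) ⬝ᵥ y ℓ = 0 := fun ℓ => by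
    rw [dotProduct_comm]
    simp [hy, add_dotProduct, smul_dotProduct, dot_self_cross, dot_cross_self]
  have hdot : ∀ n : Fin 3 → ℝ, ∀ ℓ, v * (n ⬝ᵥ y (ℓ + 1)) = u * (n ⬝ᵥ y ℓ) - m ℓ * (n ⬝ᵥ C ℓ) :=
    fun n ℓ => by
      have := congrArg (n ⬝ᵥ ·) (h ℓ)
      simpa only [dotProduct_sub, dotProduct_smul, smul_eq_mul] using this
  have hm : m = 0 := by
    refine Matrix.eq_zero_of_mulVec_eq_zero hdet ?_
    funext ℓ
    change ∑ k, t4Matrix u v C T ℓ k * m k = 0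
    have e0 := hny ℓ
    have e1 := hdot (C ℓ ⨯₃ T ℓ) 0
    have e2 := hdot (C ℓ ⨯₃ T ℓ) 1
    have e3 := hdot (C ℓ ⨯₃ T ℓ) 2
    have e4 := hdot (C ℓ ⨯₃ T ℓ) 3
    simp only [Fin.sum_univ_four, t4Matrix, Matrix.of_apply]
    generalize C ℓ ⨯₃ T ℓ = n at *
    rw [show (0 + 1 : Fin 4) = 1 from rfl] at e1
    rw [show (1 + 1 : Fin 4) = 2 from rfl] at e2
    rw [show (2 + 1 : Fin 4) = 3 from rfl] at e3
    rw [show (3 + 1 : Fin 4) = 0 from rfl] at e4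
    match ℓ with
    | 0 =>
      simp
      linear_combination (u ^ 4 - v ^ 4) * e0 + u ^ 3 * e1 + u ^ 2 * v * e2 +
        u * v ^ 2 * e3 + v ^ 3 * e4
    | 1 =>
      simp
      linear_combination (u ^ 4 - v ^ 4) * e0 + u ^ 3 * e2 + u ^ 2 * v * e3 +
        u * v ^ 2 * e4 + v ^ 3 * e1
    | 2 =>
      simp
      linear_combination (u ^ 4 - v ^ 4) * e0 + u ^ 3 * e3 + u ^ 2 * v * e4 +
        u * v ^ 2 * e1 + v ^ 3 * e2
    | 3 =>
      simp
      linear_combination (u ^ 4 - v ^ 4) * e0 + u ^ 3 * e4 + u ^ 2 * v * e1 +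
        u * v ^ 2 * e2 + v ^ 3 * e3
  have hy0 : ∀ ℓ, y ℓ = 0 := by
    have hs : ∀ ℓ, v • y (ℓ + 1) = u • y ℓ := fun ℓ => by
      have := h ℓ
      rwa [hm, Pi.zero_apply, zero_smul, sub_zero] at this
    intro ℓ
    have h4 : (u ^ 4 - v ^ 4) • y ℓ = 0 := by
      have e1 := hs ℓ
      have e2 := hs (ℓ + 1)
      have e3 := hs (ℓ + 1 + 1)
      have e4 := hs (ℓ + 1 + 1 + 1)
      rw [show ℓ + 1 + 1 + 1 + 1 = ℓ by fin_cases ℓ <;> rfl] at e4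
      funext j
      have e1 := congrFun e1 j
      have e2 := congrFun e2 j
      have e3 := congrFun e3 j
      have e4 := congrFun e4 j
      simp only [Pi.smul_apply, smul_eq_mul, Pi.zero_apply] at e1 e2 e3 e4 ⊢
      linear_combination -u ^ 3 * e1 - u ^ 2 * v * e2 - u * v ^ 2 * e3 - v ^ 3 * e4
    exact (smul_eq_zero.1 h4).resolve_left (sub_ne_zero.2 huv)
  refine ⟨funext fun ℓ => ?_, funext fun ℓ => ?_, hm⟩
  · have := congrArg (· ⨯₃ T ℓ) (hy0 ℓ)
    simp only [hy, map_add, map_smul, LinearMap.add_apply, LinearMap.smul_apply, cross_self,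
      smul_zero, add_zero, map_zero, LinearMap.zero_apply] at this
    exact (smul_eq_zero.1 this).resolve_right (hcross ℓ)
  · have := congrArg (C ℓ ⨯₃ ·) (hy0 ℓ)
    simp only [hy, map_add, map_smul, cross_self, smul_zero, zero_add, map_zero] at this
    exact (smul_eq_zero.1 this).resolve_right (hcross ℓ)

/-- A nondegenerate `T₄` configuration with directions on the curves `γ ℓ`, which sweep out part of
the cone `Λ`, persists under small perturbations of its outer points, with inner points depending
analytically on the outer ones. -/
theorem exists_T4_inner_points {Λ : Set (Fin 3 → ℝ)} {γ : Fin 4 → ℝ → (Fin 3 → ℝ)}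
    {C T x₀ : Fin 4 → (Fin 3 → ℝ)} {κ lam : ℝ}
    (hγ : ∀ ℓ, ContDiff ℝ (⊤ : WithTop ℕ∞) (γ ℓ)) (hγΛ : ∀ ℓ (μ s : ℝ), μ • γ ℓ s ∈ Λ)
    (hγ0 : ∀ ℓ, γ ℓ 0 = C ℓ) (hγT : ∀ ℓ, HasDerivAt (γ ℓ) (T ℓ) 0)
    (hκ : κ ≠ 0) (hlam : lam ∈ Set.Ioo (0 : ℝ) 1)
    (hx₀ : ∀ ℓ, ((1 - lam) * κ) • C ℓ - κ • C (ℓ + 1) = x₀ ℓ - x₀ (ℓ + 1))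
    (hinj : ∀ a b m : Fin 4 → ℝ, (∀ ℓ, a (ℓ + 1) • C (ℓ + 1) + b (ℓ + 1) • T (ℓ + 1) =
      (1 - lam) • (a ℓ • C ℓ + b ℓ • T ℓ) - m ℓ • C ℓ) → a = 0 ∧ b = 0 ∧ m = 0) :
    ∃ P : Fin 4 → (Fin 4 → (Fin 3 → ℝ)) → (Fin 3 → ℝ),
      (∀ ℓ, ContDiffAt ℝ (⊤ : WithTop ℕ∞) (P ℓ) x₀) ∧ (∀ ℓ, P ℓ x₀ = x₀ ℓ - κ • C ℓ) ∧
      ∀ᶠ X in nhds x₀, ∀ ℓ, IsLaminateOf Λ X (P ℓ X) ∧ P ℓ X - X ℓ ∈ Λ := by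
  set H : (Fin 4 → (Fin 3 → ℝ)) → (Fin 4 → (Fin 3 → ℝ)) := fun u ℓ =>
    ((1 - u ℓ 2) * u ℓ 0) • γ ℓ (u ℓ 1) - u (ℓ + 1) 0 • γ (ℓ + 1) (u (ℓ + 1) 1) with hH
  set u₀ : Fin 4 → (Fin 3 → ℝ) := fun _ => ![κ, 0, lam] with hu₀
  have hcoord : ∀ (ℓ : Fin 4) (j : Fin 3), ContDiff ℝ (⊤ : WithTop ℕ∞)
      fun u : Fin 4 → (Fin 3 → ℝ) => u ℓ j := fun ℓ j => by fun_prop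
  have hHsmooth : ContDiff ℝ (⊤ : WithTop ℕ∞) H := by
    refine contDiff_pi.2 fun ℓ => ?_
    exact (((contDiff_const.sub (hcoord ℓ 2)).mul (hcoord ℓ 0)).smul
      ((hγ ℓ).comp (hcoord ℓ 1))).sub
      ((hcoord (ℓ + 1) 0).smul ((hγ (ℓ + 1)).comp (hcoord (ℓ + 1) 1)))
  have hHu₀ : H u₀ = fun ℓ => x₀ ℓ - x₀ (ℓ + 1) := by
    funext ℓ
    simp [hH, hu₀, hγ0, ← hx₀]
  have hderiv : ∀ v, fderiv ℝ H u₀ v = fun ℓ =>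
      ((1 - lam) • (v ℓ 0 • C ℓ + (κ * v ℓ 1) • T ℓ) - (κ * v ℓ 2) • C ℓ) -
        (v (ℓ + 1) 0 • C (ℓ + 1) + (κ * v (ℓ + 1) 1) • T (ℓ + 1)) := by
    intro v
    have hline : ∀ ℓ j, HasDerivAt (fun τ : ℝ => (u₀ + τ • v) ℓ j) (v ℓ j) 0 := fun ℓ j => by
      simpa using ((hasDerivAt_id (0 : ℝ)).mul_const (v ℓ j)).const_add (u₀ ℓ j)
    have hcurve : ∀ ℓ, HasDerivAt (fun τ : ℝ => γ ℓ ((u₀ + τ • v) ℓ 1)) (v ℓ 1 • T ℓ) 0 :=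
      fun ℓ => by
        refine HasDerivAt.scomp (h := fun τ : ℝ => (u₀ + τ • v) ℓ 1) (0 : ℝ) ?_ (hline ℓ 1)
        simpa [hu₀] using hγT ℓ
    have h1 : HasDerivAt (fun τ : ℝ => H (u₀ + τ • v)) (fderiv ℝ H u₀ v) 0 := by
      have hl : HasDerivAt (fun τ : ℝ => u₀ + τ • v) v 0 := by
        simpa using ((hasDerivAt_id (0 : ℝ)).smul_const v).const_add u₀
      have hF : HasFDerivAt H (fderiv ℝ H u₀) (u₀ + (0 : ℝ) • v) := by
        simpa using ((hHsmooth.differentiable (by simp)) u₀).hasFDerivAt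
      exact hF.comp_hasDerivAt (0 : ℝ) hl
    refine h1.unique (hasDerivAt_pi.2 fun ℓ => ?_)
    refine (((((hline ℓ 2).const_sub 1).mul (hline ℓ 0)).smul (hcurve ℓ)).sub
      ((hline (ℓ + 1) 0).smul (hcurve (ℓ + 1)))).congr_deriv ?_
    simp only [hu₀, hγ0, zero_smul, add_zero, Matrix.cons_val, Pi.mul_apply, Pi.add_apply,
      Pi.zero_apply]
    module
  obtain ⟨g, hg, hgu₀, hHg⟩ := exists_analytic_right_inverse (hHsmooth.contDiffAt (x := u₀))
    fun v hv => by
      obtain ⟨h0, h1, h2⟩ := hinj (fun ℓ => v ℓ 0) (fun ℓ => κ * v ℓ 1) (fun ℓ => κ * v ℓ 2)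
        fun ℓ => (sub_eq_zero.1 (congrFun ((hderiv v).symm.trans hv) ℓ)).symm
      funext ℓ j
      have h0 := congrFun h0 ℓ
      have h1 := congrFun h1 ℓ
      have h2 := congrFun h2 ℓ
      simp only [Pi.zero_apply, mul_eq_zero, hκ, false_or] at h0 h1 h2
      fin_cases j <;> simpa
  set u : (Fin 4 → (Fin 3 → ℝ)) → (Fin 4 → (Fin 3 → ℝ)) :=
    fun X => g fun ℓ => X ℓ - X (ℓ + 1) with hu
  have hsub : ContDiff ℝ (⊤ : WithTop ℕ∞)
      fun (X : Fin 4 → (Fin 3 → ℝ)) (ℓ : Fin 4) => X ℓ - X (ℓ + 1) := by fun_prop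
  have hux₀ : u x₀ = u₀ := by rw [hu]; simp only [← hHu₀, hgu₀]
  have husmooth : ContDiffAt ℝ (⊤ : WithTop ℕ∞) u x₀ := by
    rw [hHu₀] at hg
    exact hg.comp x₀ hsub.contDiffAt
  have hucoord : ∀ ℓ j, ContDiffAt ℝ (⊤ : WithTop ℕ∞) (fun X => u X ℓ j) x₀ := fun ℓ j =>
    (hcoord ℓ j).contDiffAt.comp x₀ husmooth
  refine ⟨fun ℓ X => X ℓ - u X ℓ 0 • γ ℓ (u X ℓ 1), fun ℓ => ?_, fun ℓ => ?_, ?_⟩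
  · exact (contDiff_apply ℝ (Fin 3 → ℝ) ℓ).contDiffAt.sub
      ((hucoord ℓ 0).smul ((hγ ℓ).contDiffAt.comp x₀ (hucoord ℓ 1)))
  · simp [hux₀, hu₀, hγ0]
  · have hev1 : ∀ᶠ X in nhds x₀, H (u X) = fun ℓ => X ℓ - X (ℓ + 1) := by
      rw [hHu₀] at hHg
      exact hsub.continuous.continuousAt.eventually hHg
    have hev2 : ∀ᶠ X in nhds x₀, ∀ ℓ, u X ℓ 2 ∈ Set.Ioo (0 : ℝ) 1 := by
      refine Filter.eventually_all.2 fun ℓ => ?_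
      refine (hucoord ℓ 2).continuousAt.eventually (isOpen_Ioo.mem_nhds ?_)
      simpa [hux₀, hu₀] using hlam
    filter_upwards [hev1, hev2] with X hX1 hX2 ℓ
    refine ⟨isLaminateOf_T4 (p := fun ℓ => X ℓ - u X ℓ 0 • γ ℓ (u X ℓ 1)) hX2 (fun ℓ => ?_)
      (fun ℓ => ?_) ℓ, ?_⟩
    · have := congrFun hX1 ℓ
      simp only [hH] at this
      rw [← sub_eq_zero] at this ⊢
      rw [← this]
      module
    · simpa using hγΛ ℓ (u X ℓ 0) (u X ℓ 1)
    · simpa using hγΛ ℓ (-u X ℓ 0) (u X ℓ 1)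

theorem det_t4Matrix_int_ne_zero : ∀ i : Fin 3,
    (t4Matrix ((i : ℕ) + 1 : ℤ) ((i : ℕ) + 2 : ℤ) (cInt i) (tangentInt i)).det ≠ 0 := by
  decide +kernel

theorem det_t4Matrix_cast (u v : ℤ) (C T : Fin 4 → (Fin 3 → ℤ)) :
    ((t4Matrix u v C T).det : ℝ) = (t4Matrix (u : ℝ) (v : ℝ)
      (fun ℓ j => (C ℓ j : ℝ)) (fun ℓ j => (T ℓ j : ℝ))).det := by
  rw [Int.cast_det]
  congr 1
  ext ℓ k
  simp only [t4Matrix, Matrix.map_apply, Matrix.of_apply, cross_apply, dotProduct,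
    Fin.sum_univ_three, Matrix.cons_val]
  push_cast
  rfl

theorem cross_cast_ne_zero {C T : Fin 3 → ℤ} (h : C ⨯₃ T ≠ 0) :
    (fun j => (C j : ℝ)) ⨯₃ (fun j => (T j : ℝ)) ≠ 0 := by
  refine fun h0 => h ?_
  ext j
  have := congrFun h0 j
  fin_cases j <;> simp [cross_apply] at this ⊢ <;> exact_mod_cast this

theorem smul_eval_mem_LamA (q : Fin 3 → MvPolynomial (Fin 2) ℝ) {ξ : Fin 2 → ℝ} (hξ : ξ ≠ 0)
    (μ : ℝ) : (μ • fun j => MvPolynomial.eval ξ (q j)) ∈ LamA q := by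
  refine ⟨ξ, hξ, ?_⟩
  funext j
  fin_cases j <;> simp [AMat, Matrix.mulVec, dotProduct, Fin.sum_univ_three] <;> ring

/-- A curve in the wave cone through `cInt i ℓ` with velocity `tangentInt i ℓ` there, obtained by
moving the second coordinate of the frequency `xiVal i ℓ`. -/
noncomputable def coneCurve (q : Fin 3 → MvPolynomial (Fin 2) ℝ) (i : Fin 3) (ℓ : Fin 4) (s : ℝ) :
    Fin 3 → ℝ :=
  (cDen i : ℝ) • fun j =>
    MvPolynomial.eval ![(xiInt i ℓ 0 : ℝ), xiInt i ℓ 1 + (qDen : ℝ) / cDen i * s] (q j)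

theorem cDen_ne_zero (i : Fin 3) : (cDen i : ℝ) ≠ 0 := by
  fin_cases i <;> norm_num [cDen]

theorem qDen_ne_zero : (qDen : ℝ) ≠ 0 := by
  norm_num [qDen]

theorem xiInt_zero_ne_zero (i : Fin 3) (ℓ : Fin 4) : xiInt i ℓ 0 ≠ 0 := by
  revert i ℓ
  decide

theorem smul_coneCurve_mem (q : Fin 3 → MvPolynomial (Fin 2) ℝ) (i : Fin 3) (ℓ : Fin 4)
    (μ s : ℝ) : μ • coneCurve q i ℓ s ∈ LamA q := by
  rw [coneCurve, smul_smul]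
  refine smul_eval_mem_LamA q (fun h => ?_) _
  have := congrFun h 0
  simp [xiInt_zero_ne_zero] at this

section

variable {q : Fin 3 → MvPolynomial (Fin 2) ℝ} (hq : InterpCond q) (i : Fin 3) (ℓ : Fin 4)

include hq

theorem coneCurve_apply (s : ℝ) (j : Fin 3) : coneCurve q i ℓ s j =
    (cDen i : ℝ) / qDen * ∑ m : Fin 12, (qNum m j : ℝ) *
      ((xiInt i ℓ 0 : ℝ) ^ (m : ℕ) *
        (xiInt i ℓ 1 + (qDen : ℝ) / cDen i * s) ^ (m.rev : ℕ)) := by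
  have h := qDen_mul_eval hq j ![(xiInt i ℓ 0 : ℝ), xiInt i ℓ 1 + (qDen : ℝ) / cDen i * s]
  simp only [Matrix.cons_val] at h
  rw [← h, ← mul_assoc, div_mul_cancel₀ _ qDen_ne_zero]
  rfl

theorem contDiff_coneCurve : ContDiff ℝ (⊤ : WithTop ℕ∞) (coneCurve q i ℓ) := by
  refine contDiff_pi.2 fun j => ?_
  simp only [coneCurve_apply hq]
  fun_prop

theorem coneCurve_zero : coneCurve q i ℓ 0 = fun j => (cInt i ℓ j : ℝ) := by
  funext j
  have h : ![(xiInt i ℓ 0 : ℝ), xiInt i ℓ 1] = xiVal i ℓ := by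
    funext k
    rw [xiVal_eq_cast]
    fin_cases k <;> rfl
  simp [coneCurve, h, hq.2, cDen_mul_cVal]

theorem hasDerivAt_coneCurve :
    HasDerivAt (coneCurve q i ℓ) (fun j => (tangentInt i ℓ j : ℝ)) 0 := by
  refine hasDerivAt_pi.2 fun j => ?_
  simp only [coneCurve_apply hq]
  have hline : HasDerivAt (fun s : ℝ => (xiInt i ℓ 1 : ℝ) + (qDen : ℝ) / cDen i * s)
      ((qDen : ℝ) / cDen i) 0 := by
    simpa using ((hasDerivAt_id (0 : ℝ)).const_mul ((qDen : ℝ) / cDen i)).const_add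
      (xiInt i ℓ 1 : ℝ)
  refine ((HasDerivAt.fun_sum fun (m : Fin 12) _ => ((hline.pow (m.rev : ℕ)).const_mul
    ((xiInt i ℓ 0 : ℝ) ^ (m : ℕ))).const_mul (qNum m j : ℝ)).const_mul _).congr_deriv ?_
  rw [tangentInt, Finset.mul_sum]
  push_cast
  refine Finset.sum_congr rfl fun m _ => ?_
  have h1 := cDen_ne_zero i
  have h2 := qDen_ne_zero
  simp only [mul_zero, add_zero]
  field_simp

end

theorem inner_coefficients_eq_zero (i : Fin 3) {a b m : Fin 4 → ℝ}
    (h : ∀ ℓ, (((a (ℓ + 1) • fun j => (cInt i (ℓ + 1) j : ℝ)) +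
      b (ℓ + 1) • fun j => (tangentInt i (ℓ + 1) j : ℝ)) : Fin 3 → ℝ) =
      (1 - 1 / ((i : ℕ) + 2 : ℝ)) • ((a ℓ • fun j => (cInt i ℓ j : ℝ)) +
        b ℓ • fun j => (tangentInt i ℓ j : ℝ)) - m ℓ • fun j => (cInt i ℓ j : ℝ)) :
    a = 0 ∧ b = 0 ∧ m = 0 := by
  have hv : ((i : ℕ) + 2 : ℝ) ≠ 0 := by positivity
  have hdet := Int.cast_ne_zero (α := ℝ).2 (det_t4Matrix_int_ne_zero i)
  rw [det_t4Matrix_cast] at hdet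
  push_cast at hdet
  have huv : ((i : ℕ) + 1 : ℝ) ^ 4 ≠ ((i : ℕ) + 2 : ℝ) ^ 4 := by
    refine ne_of_lt ?_
    gcongr
    norm_num
  have hm : ∀ ℓ, ((i : ℕ) + 2 : ℝ) • (((a (ℓ + 1) • fun j => (cInt i (ℓ + 1) j : ℝ)) +
      b (ℓ + 1) • fun j => (tangentInt i (ℓ + 1) j : ℝ)) : Fin 3 → ℝ) =
      ((i : ℕ) + 1 : ℝ) • ((a ℓ • fun j => (cInt i ℓ j : ℝ)) +
        b ℓ • fun j => (tangentInt i ℓ j : ℝ)) -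
      (((i : ℕ) + 2 : ℝ) • m) ℓ • fun j => (cInt i ℓ j : ℝ) := fun ℓ => by
    rw [h ℓ, smul_sub, smul_smul, smul_smul, Pi.smul_apply, smul_eq_mul]
    congr 2
    field_simp
    ring
  obtain ⟨ha, hb, hm⟩ := t4_injective huv hdet
    (fun ℓ => cross_cast_ne_zero (cross_cInt_tangentInt_ne_zero i ℓ)) hm
  exact ⟨ha, hb, (smul_eq_zero.1 hm).resolve_left hv⟩

theorem sigmaP_sigmaInv (i : Fin 3) (ℓ : Fin 4) : sigmaP i (sigmaInv i ℓ) = ℓ := by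
  revert i ℓ
  decide

theorem aPt_apply (ℓ : Fin 4) (j : Fin 3) :
    aPt ℓ j = ((if ℓ = j.succ then 1 else 0 : ℤ) : ℝ) := by
  fin_cases ℓ <;> fin_cases j <;> simp [aPt]

theorem T4_relation_int : ∀ (i : Fin 3) (ℓ : Fin 4) (j : Fin 3),
    ((i : ℕ) + 1 : ℤ) * cInt i ℓ j - ((i : ℕ) + 2 : ℤ) * cInt i (ℓ + 1) j =
      cDen i * ((if sigmaP i ℓ = j.succ then 1 else 0) -
        if sigmaP i (ℓ + 1) = j.succ then 1 else 0) := by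
  decide +kernel

/-- Each state `aPt ℓ` is an outer point of three `T₄` configurations, and the corresponding inner
points `P i ℓ` depend analytically on the quadruple of states. -/
theorem exists_inner_point_maps {q : Fin 3 → MvPolynomial (Fin 2) ℝ} (hq : InterpCond q)
    (i : Fin 3) : ∃ P : Fin 4 → (Fin 4 → (Fin 3 → ℝ)) → (Fin 3 → ℝ),
      (∀ ℓ, ContDiffAt ℝ (⊤ : WithTop ℕ∞) (P ℓ) aPt) ∧
      (∀ ℓ, P ℓ aPt - aPt ℓ =
        (-(((i : ℕ) + 2 : ℝ) / cDen i)) • fun j => (cInt i (sigmaInv i ℓ) j : ℝ)) ∧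
      ∀ᶠ X in nhds aPt, ∀ ℓ, IsLaminateOf (LamA q) X (P ℓ X) ∧ P ℓ X - X ℓ ∈ LamA q := by
  have hk : (0 : ℝ) < (i : ℕ) + 2 := by positivity
  obtain ⟨P, hP, hPx, hPev⟩ := exists_T4_inner_points (Λ := LamA q) (γ := coneCurve q i)
    (x₀ := fun ℓ => aPt (sigmaP i ℓ)) (κ := ((i : ℕ) + 2 : ℝ) / cDen i)
    (lam := 1 / ((i : ℕ) + 2 : ℝ)) (contDiff_coneCurve hq i) (smul_coneCurve_mem q i)
    (coneCurve_zero hq i) (hasDerivAt_coneCurve hq i) (div_ne_zero hk.ne' (cDen_ne_zero i))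
    ⟨by positivity, (div_lt_one hk).2 (by linarith [(Nat.cast_nonneg (i : ℕ) : (0 : ℝ) ≤ _)])⟩
    (fun ℓ => by
      funext j
      have h := congrArg (Int.cast : ℤ → ℝ) (T4_relation_int i ℓ j)
      rw [Int.cast_mul, Int.cast_sub, Int.cast_sub, ← aPt_apply, ← aPt_apply] at h
      push_cast at h
      refine mul_left_cancel₀ (cDen_ne_zero i) ?_
      simp only [Pi.sub_apply, Pi.smul_apply, smul_eq_mul]
      rw [← h]
      field_simp [cDen_ne_zero i]
      ring)
    fun a b m h => inner_coefficients_eq_zero i h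
  have hσ : ContDiff ℝ (⊤ : WithTop ℕ∞)
      fun (X : Fin 4 → (Fin 3 → ℝ)) (ℓ : Fin 4) => X (sigmaP i ℓ) := by fun_prop
  refine ⟨fun ℓ X => P (sigmaInv i ℓ) fun k => X (sigmaP i k), fun ℓ => ?_, fun ℓ => ?_, ?_⟩
  · exact (hP _).comp aPt hσ.contDiffAt
  · change (P (sigmaInv i ℓ) fun k => aPt (sigmaP i k)) - aPt ℓ = _
    rw [hPx, sigmaP_sigmaInv]
    module
  · filter_upwards [hσ.continuous.continuousAt.eventually hPev] with X hX ℓ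
    obtain ⟨h1, h2⟩ := hX (sigmaInv i ℓ)
    rw [sigmaP_sigmaInv] at h2
    exact ⟨h1.trans fun k => IsLaminateOf.self _, h2⟩

theorem det_inner_directions_ne_zero : ∀ ℓ : Fin 4,
    (Matrix.of fun i : Fin 3 => cInt i (sigmaInv i ℓ)).det ≠ 0 := by
  decide +kernel

/-- Move each point `Z ℓ` of a quadruple towards `P ℓ Z` by the proportion `s`. -/
def shift (P : Fin 4 → (Fin 4 → (Fin 3 → ℝ)) → (Fin 3 → ℝ)) (s : ℝ) (Z : Fin 4 → (Fin 3 → ℝ)) :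
    Fin 4 → (Fin 3 → ℝ) :=
  fun ℓ => Z ℓ + s • (P ℓ Z - Z ℓ)

section shift

variable {P : Fin 4 → (Fin 4 → (Fin 3 → ℝ)) → (Fin 3 → ℝ)} {x₀ : Fin 4 → (Fin 3 → ℝ)}

@[simp]
theorem shift_zero (Z : Fin 4 → (Fin 3 → ℝ)) : shift P 0 Z = Z := by
  funext ℓ
  simp [shift]

theorem contDiffAt_shift {E : Type*} [NormedAddCommGroup E] [NormedSpace ℝ E] {s : E → ℝ}
    {Z : E → (Fin 4 → (Fin 3 → ℝ))} {a : E} {n : WithTop ℕ∞}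
    (hP : ∀ ℓ, ContDiffAt ℝ n (P ℓ) x₀) (hs : ContDiffAt ℝ n s a) (hZ : ContDiffAt ℝ n Z a)
    (hZa : Z a = x₀) : ContDiffAt ℝ n (fun e => shift P (s e) (Z e)) a := by
  subst hZa
  refine contDiffAt_pi.2 fun ℓ => ?_
  have hZℓ : ContDiffAt ℝ n (fun e => Z e ℓ) a := contDiffAt_pi.1 hZ ℓ
  exact hZℓ.add (hs.smul (((hP ℓ).comp a hZ).sub hZℓ))

theorem hasDerivAt_shift {s : ℝ → ℝ} {Z : ℝ → (Fin 4 → (Fin 3 → ℝ))} {v τ : ℝ}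
    {w : Fin 4 → (Fin 3 → ℝ)} (hP : ∀ ℓ, DifferentiableAt ℝ (P ℓ) x₀) (hs : HasDerivAt s v τ)
    (hs0 : s τ = 0) (hZ : HasDerivAt Z w τ) (hZ0 : Z τ = x₀) :
    HasDerivAt (fun τ => shift P (s τ) (Z τ)) (fun ℓ => w ℓ + v • (P ℓ x₀ - x₀ ℓ)) τ := by
  subst hZ0
  refine hasDerivAt_pi.2 fun ℓ => ?_
  have hZℓ := hasDerivAt_pi.1 hZ ℓ
  refine (hZℓ.add (hs.smul (((hP ℓ).hasFDerivAt.comp_hasDerivAt τ hZ).sub hZℓ))).congr_deriv ?_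
  simp [hs0]

theorem isLaminateOf_shift {Λ : Set (Fin 3 → ℝ)} {Z : Fin 4 → (Fin 3 → ℝ)} {s : ℝ}
    (hP : ∀ ℓ, IsLaminateOf Λ Z (P ℓ Z) ∧ P ℓ Z - Z ℓ ∈ Λ) (hs : s ∈ Set.Icc (0 : ℝ) 1)
    (ℓ : Fin 4) : IsLaminateOf Λ Z (shift P s Z ℓ) := by
  have h := (hP ℓ).1.segment (IsLaminateOf.self ℓ) (hP ℓ).2 hs
  rwa [show s • P ℓ Z + (1 - s) • Z ℓ = shift P s Z ℓ by rw [shift]; module] at h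

end shift

/-- The successive shifts of the quadruple `z.2` towards `P 0`, `P 1`, `P 2` by the proportions
given by the coordinates of `z.1`. -/
def tripleShift (P : Fin 3 → Fin 4 → (Fin 4 → (Fin 3 → ℝ)) → (Fin 3 → ℝ))
    (z : (Fin 3 → ℝ) × (Fin 4 → (Fin 3 → ℝ))) : Fin 4 → (Fin 3 → ℝ) :=
  shift (P 2) (z.1 2) (shift (P 1) (z.1 1) (shift (P 0) (z.1 0) z.2))

section tripleShift

variable {P : Fin 3 → Fin 4 → (Fin 4 → (Fin 3 → ℝ)) → (Fin 3 → ℝ)} {x₀ : Fin 4 → (Fin 3 → ℝ)}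
  {n : WithTop ℕ∞} (hP : ∀ i ℓ, ContDiffAt ℝ n (P i ℓ) x₀)

theorem tripleShift_zero (X : Fin 4 → (Fin 3 → ℝ)) : tripleShift P (0, X) = X := by
  simp [tripleShift]

theorem contDiff_fst_apply (i : Fin 3) :
    ContDiff ℝ n fun z : (Fin 3 → ℝ) × (Fin 4 → (Fin 3 → ℝ)) => z.1 i :=
  (contDiff_apply ℝ ℝ i).comp contDiff_fst

include hP

theorem contDiffAt_shift_fst :
    ContDiffAt ℝ n (fun z : (Fin 3 → ℝ) × _ => shift (P 0) (z.1 0) z.2) (0, x₀) :=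
  contDiffAt_shift (hP 0) (contDiff_fst_apply 0).contDiffAt contDiffAt_snd rfl

theorem contDiffAt_shift_shift_fst :
    ContDiffAt ℝ n (fun z : (Fin 3 → ℝ) × _ =>
      shift (P 1) (z.1 1) (shift (P 0) (z.1 0) z.2)) (0, x₀) :=
  contDiffAt_shift (hP 1) (contDiff_fst_apply 1).contDiffAt (contDiffAt_shift_fst hP) (by simp)

theorem contDiffAt_tripleShift : ContDiffAt ℝ n (tripleShift P) (0, x₀) :=
  contDiffAt_shift (hP 2) (contDiff_fst_apply 2).contDiffAt (contDiffAt_shift_shift_fst hP)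
    (by simp)

theorem fderiv_tripleShift (hn : n ≠ 0) (v : Fin 3 → ℝ) (ℓ : Fin 4) :
    fderiv ℝ (fun z => tripleShift P z ℓ) (0, x₀) (v, 0) =
      ∑ i, v i • (P i ℓ x₀ - x₀ ℓ) := by
  have hd : ∀ i ℓ, DifferentiableAt ℝ (P i ℓ) x₀ := fun i ℓ => (hP i ℓ).differentiableAt hn
  have hs : ∀ i, HasDerivAt (fun τ : ℝ => τ * v i) (v i) 0 := fun i => by
    simpa using (hasDerivAt_id (0 : ℝ)).mul_const (v i)
  have h0 := hasDerivAt_shift (hd 0) (hs 0) (by simp) (hasDerivAt_const (0 : ℝ) x₀) rfl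
  have h1 := hasDerivAt_shift (hd 1) (hs 1) (by simp) h0 (by simp)
  have h2 := hasDerivAt_pi.1 (hasDerivAt_shift (hd 2) (hs 2) (by simp) h1 (by simp)) ℓ
  have hl : HasDerivAt (fun τ : ℝ => (τ • v, x₀)) (v, (0 : Fin 4 → (Fin 3 → ℝ))) 0 := by
    refine HasDerivAt.prodMk ?_ (hasDerivAt_const _ _)
    simpa using (hasDerivAt_id (0 : ℝ)).smul_const v
  have hF : HasFDerivAt (fun z => tripleShift P z ℓ)
      (fderiv ℝ (fun z => tripleShift P z ℓ) (0, x₀)) ((0 : ℝ) • v, x₀) := by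
    rw [zero_smul]
    exact ((contDiffAt_pi.1 (contDiffAt_tripleShift hP) ℓ).differentiableAt hn).hasFDerivAt
  have hcomp : HasDerivAt (fun τ : ℝ => tripleShift P (τ • v, x₀) ℓ)
      (fderiv ℝ (fun z => tripleShift P z ℓ) (0, x₀) (v, 0)) 0 :=
    HasFDerivAt.comp_hasDerivAt (l := fun z => tripleShift P z ℓ) (0 : ℝ) hF hl
  refine hcomp.unique (h2.congr_deriv ?_)
  simp [Fin.sum_univ_three]

theorem eventually_isLaminateOf_tripleShift {Λ : Set (Fin 3 → ℝ)}
    (hΛ : ∀ i, ∀ᶠ X in nhds x₀, ∀ ℓ, IsLaminateOf Λ X (P i ℓ X) ∧ P i ℓ X - X ℓ ∈ Λ) :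
    ∀ᶠ z in nhds ((0 : Fin 3 → ℝ), x₀), (∀ i, z.1 i ∈ Set.Icc (0 : ℝ) 1) →
      ∀ ℓ, IsLaminateOf Λ z.2 (tripleShift P z ℓ) := by
  have h0 : ContinuousAt (fun z : (Fin 3 → ℝ) × (Fin 4 → (Fin 3 → ℝ)) => z.2) (0, x₀) :=
    continuousAt_snd
  have h1 := (contDiffAt_shift_fst hP).continuousAt
  have h2 := (contDiffAt_shift_shift_fst hP).continuousAt
  rw [ContinuousAt] at h0 h1 h2
  simp only [Pi.zero_apply, shift_zero] at h1 h2
  filter_upwards [h0.eventually (hΛ 0), h1.eventually (hΛ 1), h2.eventually (hΛ 2)]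
    with z hz0 hz1 hz2 hz ℓ
  exact IsLaminateOf.trans (isLaminateOf_shift hz0 (hz 0)) <|
    IsLaminateOf.trans (isLaminateOf_shift hz1 (hz 1)) (isLaminateOf_shift hz2 (hz 2) ℓ)

end tripleShift

theorem exists_ball_prod_of_eventually {α β : Type*} [PseudoMetricSpace α] [PseudoMetricSpace β]
    {a : α} {b : β} {p : α × β → Prop} (h : ∀ᶠ z in nhds (a, b), p z) :
    ∃ δ : ℝ, 0 < δ ∧ δ ≤ 1 ∧ ∀ x ∈ Metric.ball a δ, ∀ y ∈ Metric.ball b δ, p (x, y) := by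
  obtain ⟨ε, hε, hp⟩ := Metric.eventually_nhds_iff_ball.1 h
  refine ⟨min ε 1, by positivity, min_le_right _ _, fun x hx y hy => hp _ ?_⟩
  rw [← ball_prod_same]
  exact ⟨Metric.ball_subset_ball (min_le_left _ _) hx, Metric.ball_subset_ball (min_le_left _ _) hy⟩

/-- **Proposition 5.7 of the paper:** smooth families of points in the `Λ_𝒜`-convex hull of
nearby quadruples, emanating from each of the four states. -/
theorem hull_probing_maps
    (q : Fin 3 → MvPolynomial (Fin 2) ℝ) (hq : InterpCond q) :
    ∃ δ : ℝ, 0 < δ ∧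
      ∃ π : Fin 4 → ((Fin 3 → ℝ) × (Fin 4 → (Fin 3 → ℝ))) → (Fin 3 → ℝ),
        -- smoothness of the maps `π_ℓ` on `(-δ,δ)³ × B_δ(A₁)`
        (∀ ℓ : Fin 4, ContDiffOn ℝ (⊤ : ℕ∞) (π ℓ)
          ((Metric.ball (0 : Fin 3 → ℝ) δ) ×ˢ (Metric.ball aPt δ))) ∧
        -- (i) `t ↦ π_ℓ(t, X)` is an embedding for each fixed `X`
        (∀ ℓ : Fin 4, ∀ X ∈ Metric.ball aPt δ,
          Topology.IsEmbedding fun t : Metric.ball (0 : Fin 3 → ℝ) δ => π ℓ ((t : Fin 3 → ℝ), X)) ∧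
        -- (ii) `π_ℓ(t, X)` lies in the `Λ_𝒜`-convex hull of `{x₁, x₂, x₃, x₄}` for `t ∈ [0,δ)³`
        (∀ ℓ : Fin 4, ∀ X ∈ Metric.ball aPt δ, ∀ t : Fin 3 → ℝ,
          (∀ j : Fin 3, 0 ≤ t j ∧ t j < δ) →
          π ℓ (t, X) ∈ lamHull (LamA q) {X 0, X 1, X 2, X 3}) ∧
        -- (iii) `π_ℓ(0, X) = x_ℓ`
        (∀ ℓ : Fin 4, ∀ X ∈ Metric.ball aPt δ, π ℓ (0, X) = X ℓ) := by
  choose P hP hPx hPΛ using exists_inner_point_maps hq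
  have hsmooth := contDiffAt_tripleShift hP
  have hsmooth' := contDiffAt_pi.1 hsmooth
  have hinj : ∀ ℓ (v : Fin 3 → ℝ),
      fderiv ℝ (fun z => tripleShift P z ℓ) (0, aPt) (v, 0) = 0 → v = 0 := fun ℓ v hv => by
    rw [fderiv_tripleShift hP (by simp)] at hv
    simp only [hPx, smul_smul] at hv
    have hdet : (Matrix.of fun i j : Fin 3 => (cInt i (sigmaInv i ℓ) j : ℝ)).det ≠ 0 := by
      have := Int.cast_ne_zero (α := ℝ).2 (det_inner_directions_ne_zero ℓ)
      rwa [Int.cast_det] at this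
    have h0 := Matrix.eq_zero_of_vecMul_eq_zero hdet
      (v := fun i => v i * -(((i : ℕ) + 2 : ℝ) / cDen i)) (by
        rw [← hv]
        funext j
        simp [Matrix.vecMul, dotProduct, Finset.sum_apply])
    funext i
    have hc : -(((i : ℕ) + 2 : ℝ) / cDen i) ≠ 0 :=
      neg_ne_zero.2 (div_ne_zero (by positivity) (cDen_ne_zero i))
    exact (mul_eq_zero.1 (congrFun h0 i)).resolve_right hc
  choose U hU hUemb using fun ℓ => exists_nhds_isEmbedding_slice (hsmooth' ℓ) (hinj ℓ)
  obtain ⟨δ, hδ, hδ1, hball⟩ := exists_ball_prod_of_eventually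
    (((hsmooth.eventually (by simp)).and (eventually_isLaminateOf_tripleShift hP hPΛ)).and
      (Filter.eventually_all.2 hU))
  refine ⟨δ, hδ, fun ℓ z => tripleShift P z ℓ, fun ℓ z hz => ?_, fun ℓ X hX => ?_,
    fun ℓ X hX t ht => ?_, fun ℓ X _ => congrFun (tripleShift_zero X) ℓ⟩
  · have h := (hball z.1 hz.1 z.2 hz.2).1.1
    exact ((contDiffAt_pi.1 h ℓ).of_le le_top).contDiffWithinAt
  · exact hUemb ℓ _ X fun t ht => (hball t ht X hX).2 ℓ
  · have htδ : t ∈ Metric.ball (0 : Fin 3 → ℝ) δ := by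
      rw [mem_ball_zero_iff, pi_norm_lt_iff hδ]
      intro j
      rw [Real.norm_of_nonneg (ht j).1]
      exact (ht j).2
    have h := ((hball t htδ X hX).1.2 (fun j => ⟨(ht j).1, (ht j).2.le.trans hδ1⟩) ℓ).mem_lamHull
    have hrange : Set.range X = {X 0, X 1, X 2, X 3} := by
      ext y
      simp [Fin.exists_fin_succ, eq_comm]
    rwa [hrange] at h
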